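/- Define K₂(t,ρ) = ∫_ρ^∞ e^{(3/4)t} K₃(t,s) sinh(s) (cosh s - cosh ρ)^{-1/2} ds for t > 0 and ρ > 0, where K₃(t,s) = (4πt)^{-3/2} (s/sinh s) e^{-t - s²/(4t)}. Then for every t > 0 and every ρ > 0, ∂²_ρ log K₂(t,ρ) - coth(ρ) ∂_ρ log K₂(t,ρ) > 0, where ∂_ρ, ∂²_ρ denote the first and second ordinary derivatives in ρ. -/

import Mathlib

open Real MeasureTheory

/-- The heat kernel of 3-dimensional hyperbolic space. -/
noncomputable def K₃ (t s : ℝ) : ℝ :=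
  (4 * π * t) ^ (-(3 : ℝ) / 2) * (s / Real.sinh s) * Real.exp (-t - s ^ 2 / (4 * t))

/-- The heat kernel of 2-dimensional hyperbolic space, defined from `K₃` via the
Davies–Mandouvalos integral recurrence. -/
noncomputable def K₂ (t ρ : ℝ) : ℝ :=
  ∫ s in Set.Ioi ρ,
    Real.exp ((3 / 4) * t) * K₃ t s * Real.sinh s *
      (Real.cosh s - Real.cosh ρ) ^ (-(1 : ℝ) / 2)

section helpers
open Set Filter Topology

lemma aux_pos_of_deriv {f f' : ℝ → ℝ} (hf : ∀ x, HasDerivAt f (f' x) x) (h0 : f 0 = 0)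
    (hp : ∀ x, 0 < x → 0 < f' x) : ∀ x, 0 < x → 0 < f x := by
  intro x hx
  have hm : StrictMonoOn f (Ici 0) := by
    apply strictMonoOn_of_deriv_pos (convex_Ici 0)
    · exact fun y _ => (hf y).continuousAt.continuousWithinAt
    · intro y hy
      rw [interior_Ici] at hy
      rw [(hf y).deriv]; exact hp y hy
  have := hm (mem_Ici.2 le_rfl) (mem_Ici.2 hx.le) hx
  rwa [h0] at this

lemma aux_E (w : ℝ) (hw : 0 < w) :
    0 < w ^ 2 * (cosh w + 3) - 2 * w * sinh w - 4 * cosh w + 4 := by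
  have h3 : ∀ x : ℝ, 0 < x → 0 < (x ^ 2 - 4) * sinh x + 4 * x * cosh x := by
    refine aux_pos_of_deriv (f' := fun x => 6 * x * sinh x + x ^ 2 * cosh x) ?_ (by simp) ?_
    · intro x
      have := ((((hasDerivAt_id x).pow 2).sub_const 4).mul (hasDerivAt_sinh x)).add
        (((hasDerivAt_id x).const_mul 4).mul (hasDerivAt_cosh x))
      refine HasDerivAt.congr_deriv this ?_
      simp; ring
    · intro x hx
      have := sinh_pos_iff.2 hx
      have := cosh_pos x
      positivity
  have h2 : ∀ x : ℝ, 0 < x → 0 < 6 + 2 * x * sinh x + x ^ 2 * cosh x - 6 * cosh x := by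
    refine aux_pos_of_deriv (f' := fun x => (x ^ 2 - 4) * sinh x + 4 * x * cosh x) ?_ (by simp) h3
    intro x
    have := (((((hasDerivAt_id x).const_mul 2).mul (hasDerivAt_sinh x)).const_add 6).add
        (((hasDerivAt_id x).pow 2).mul (hasDerivAt_cosh x))).sub ((hasDerivAt_cosh x).const_mul 6)
    refine HasDerivAt.congr_deriv this ?_
    simp; ring
  have h1 : ∀ x : ℝ, 0 < x → 0 < 6 * x + x ^ 2 * sinh x - 6 * sinh x := by
    refine aux_pos_of_deriv
      (f' := fun x => 6 + 2 * x * sinh x + x ^ 2 * cosh x - 6 * cosh x) ?_ (by simp) h2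
    intro x
    have := (((hasDerivAt_id x).const_mul 6).add
        (((hasDerivAt_id x).pow 2).mul (hasDerivAt_sinh x))).sub ((hasDerivAt_sinh x).const_mul 6)
    refine HasDerivAt.congr_deriv this ?_
    simp; ring
  refine aux_pos_of_deriv (f := fun w => w ^ 2 * (cosh w + 3) - 2 * w * sinh w - 4 * cosh w + 4)
    (f' := fun x => 6 * x + x ^ 2 * sinh x - 6 * sinh x) ?_ (by simp) h1 w hw
  intro x
  have := ((((((hasDerivAt_id x).pow 2).mul ((hasDerivAt_cosh x).add_const 3)).sub
      (((hasDerivAt_id x).const_mul 2).mul (hasDerivAt_sinh x)))).sub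
      ((hasDerivAt_cosh x).const_mul 4)).add_const 4
  refine HasDerivAt.congr_deriv this ?_
  simp; ring

lemma aux_ineq (s : ℝ) (hs : 0 < s) :
    s * sinh s * cosh s + sinh s ^ 2 < s ^ 2 * sinh s ^ 2 + 2 * s ^ 2 := by
  have h := aux_E (2 * s) (by positivity)
  rw [cosh_two_mul, sinh_two_mul] at h
  have h1 := cosh_sq s
  rw [h1] at h
  nlinarith

lemma aux_tanh (s : ℝ) (hs : 0 < s) : 0 < s * cosh s - sinh s := by
  refine aux_pos_of_deriv (f := fun s => s * cosh s - sinh s) (f' := fun s => s * sinh s)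
    ?_ (by simp) ?_ s hs
  · intro x
    have := ((hasDerivAt_id x).mul (hasDerivAt_cosh x)).sub (hasDerivAt_sinh x)
    refine HasDerivAt.congr_deriv this ?_
    simp
  · intro x hx
    have := sinh_pos_iff.2 hx
    positivity

noncomputable def aux_g (A t s : ℝ) : ℝ := A * (s / sinh s) * exp (-(s ^ 2 / (4 * t)))
noncomputable def aux_p (t s : ℝ) : ℝ :=
  (1 / s) * (1 / sinh s) - (cosh s / sinh s) * (1 / sinh s) - (1 / (2 * t)) * (s / sinh s)
noncomputable def aux_q (t s : ℝ) : ℝ :=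
  -((1 / s) * (1 / s) * ((1 / sinh s) * (1 / sinh s))
      + (1 / s) * (cosh s / sinh s) * ((1 / sinh s) * (1 / sinh s)))
    + (-((1 / sinh s) * (1 / sinh s))
      + 2 * ((cosh s / sinh s) * (cosh s / sinh s) * ((1 / sinh s) * (1 / sinh s))))
    + (1 / (2 * t)) * (-((1 / sinh s) * (1 / sinh s))
      + (s / sinh s) * (cosh s / sinh s) * (1 / sinh s))

lemma aux_q_pos (t s : ℝ) (ht : 0 < t) (hs : 0 < s) : 0 < aux_q t s := by
  have hS := sinh_pos_iff.2 hs
  have h1 := aux_ineq s hs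
  have h2 := aux_tanh s hs
  have h3 := cosh_sq s
  have : aux_q t s = (s ^ 2 * sinh s ^ 2 + 2 * s ^ 2 - (s * sinh s * cosh s + sinh s ^ 2))
      / (s ^ 2 * sinh s ^ 4) + (1 / (2 * t)) * ((s * cosh s - sinh s) / sinh s ^ 3) := by
    unfold aux_q
    field_simp
    rw [h3]
    ring
  rw [this]
  have := sub_pos.2 h1
  positivity

lemma aux_g_deriv (A t s : ℝ) (ht : 0 < t) (hs : 0 < s) :
    HasDerivAt (aux_g A t) (aux_g A t s * aux_p t s * sinh s) s := by
  have hS := sinh_pos_iff.2 hs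
  have := (((hasDerivAt_id s).div (hasDerivAt_sinh s) hS.ne').const_mul A).mul
    ((((hasDerivAt_id s).pow 2).div_const (4 * t)).neg.exp)
  refine HasDerivAt.congr_deriv this ?_
  unfold aux_g aux_p
  simp
  field_simp
  ring

lemma aux_p_deriv (t s : ℝ) (ht : 0 < t) (hs : 0 < s) :
    HasDerivAt (aux_p t) (aux_q t s * sinh s) s := by
  have hS := sinh_pos_iff.2 hs
  have hi := (hasDerivAt_const s (1:ℝ)).div (hasDerivAt_sinh s) hS.ne'
  have := ((((hasDerivAt_const s (1:ℝ)).div (hasDerivAt_id s) hs.ne').mul hi).sub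
    (((hasDerivAt_cosh s).div (hasDerivAt_sinh s) hS.ne').mul hi)).sub
    (((hasDerivAt_id s).div (hasDerivAt_sinh s) hS.ne').const_mul (1 / (2 * t)))
  refine HasDerivAt.congr_deriv this ?_
  unfold aux_q
  simp
  field_simp
  ring

lemma aux_gp_deriv (A t s : ℝ) (ht : 0 < t) (hs : 0 < s) :
    HasDerivAt (fun s => aux_g A t s * aux_p t s)
      (aux_g A t s * (aux_p t s * aux_p t s + aux_q t s) * sinh s) s := by
  refine HasDerivAt.congr_deriv ((aux_g_deriv A t s ht hs).mul (aux_p_deriv t s ht hs)) ?_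
  ring

/-- boundedness on a closed half-line -/
def aux_BN (a : ℝ) (F : ℝ → ℝ) : Prop := ∃ C, ∀ s, a ≤ s → |F s| ≤ C

lemma aux_BN.mul {a : ℝ} {F G : ℝ → ℝ} (hF : aux_BN a F) (hG : aux_BN a G) :
    aux_BN a (fun s => F s * G s) := by
  obtain ⟨C, hC⟩ := hF
  obtain ⟨D, hD⟩ := hG
  refine ⟨C * D, fun s hs => ?_⟩
  rw [abs_mul]
  exact mul_le_mul (hC s hs) (hD s hs) (abs_nonneg _) ((abs_nonneg _).trans (hC s hs))

lemma aux_BN.add {a : ℝ} {F G : ℝ → ℝ} (hF : aux_BN a F) (hG : aux_BN a G) :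
    aux_BN a (fun s => F s + G s) := by
  obtain ⟨C, hC⟩ := hF
  obtain ⟨D, hD⟩ := hG
  exact ⟨C + D, fun s hs => (abs_add_le _ _).trans (add_le_add (hC s hs) (hD s hs))⟩

lemma aux_BN.neg {a : ℝ} {F : ℝ → ℝ} (hF : aux_BN a F) : aux_BN a (fun s => -F s) := by
  obtain ⟨C, hC⟩ := hF
  exact ⟨C, fun s hs => by rw [abs_neg]; exact hC s hs⟩

lemma aux_BN.sub {a : ℝ} {F G : ℝ → ℝ} (hF : aux_BN a F) (hG : aux_BN a G) :
    aux_BN a (fun s => F s - G s) := by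
  simpa [sub_eq_add_neg] using hF.add hG.neg

lemma aux_BN_const (a c : ℝ) : aux_BN a (fun _ => c) := ⟨|c|, fun _ _ => le_rfl⟩

lemma aux_BN_inv {a : ℝ} (ha : 0 < a) : aux_BN a (fun s => 1 / s) := by
  refine ⟨1 / a, fun s hs => ?_⟩
  have : 0 < s := ha.trans_le hs
  rw [abs_of_pos (by positivity)]
  exact one_div_le_one_div_of_le ha hs

lemma aux_BN_sdiv {a : ℝ} (ha : 0 < a) : aux_BN a (fun s => s / sinh s) := by
  refine ⟨1, fun s hs => ?_⟩
  have h : 0 < s := ha.trans_le hs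
  have hS := sinh_pos_iff.2 h
  rw [abs_of_pos (by positivity), div_le_one hS]
  exact self_le_sinh_iff.2 h.le

lemma aux_BN_isinh {a : ℝ} (ha : 0 < a) : aux_BN a (fun s => 1 / sinh s) := by
  refine ⟨1 / a, fun s hs => ?_⟩
  have h : 0 < s := ha.trans_le hs
  have hS := sinh_pos_iff.2 h
  rw [abs_of_pos (by positivity)]
  exact one_div_le_one_div_of_le ha (hs.trans (self_le_sinh_iff.2 h.le))

lemma aux_BN_coth {a : ℝ} (ha : 0 < a) : aux_BN a (fun s => cosh s / sinh s) := by
  obtain ⟨C, hC⟩ := (aux_BN_const a 1).add (aux_BN_isinh ha)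
  refine ⟨C, fun s hs => ?_⟩
  have h : 0 < s := ha.trans_le hs
  have hS := sinh_pos_iff.2 h
  have hc := cosh_pos s
  refine le_trans ?_ (hC s hs)
  rw [abs_of_pos (by positivity), abs_of_pos (by positivity)]
  rw [div_le_iff₀ hS]
  field_simp
  nlinarith [cosh_sq s]

lemma aux_BN_g {a : ℝ} (ha : 0 < a) (A t : ℝ) (ht : 0 < t) :
    aux_BN a (fun s => aux_g A t s * cosh s) := by
  have h1 : aux_BN a (fun s => s * exp (-(s ^ 2 / (4 * t)))) := by
    refine ⟨1 + 4 * t, fun s hs => ?_⟩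
    have h : 0 < s := ha.trans_le hs
    show |s * exp (-(s ^ 2 / (4 * t)))| ≤ _
    rw [abs_of_pos (by positivity), exp_neg, ← div_eq_mul_inv, div_le_iff₀ (exp_pos _)]
    have h2 := add_one_le_exp (s ^ 2 / (4 * t))
    have h3 : s ≤ (1 + 4 * t) * (s ^ 2 / (4 * t) + 1) := by
      have : (1 + 4 * t) * (s ^ 2 / (4 * t) + 1) = s ^ 2 / (4 * t) + 1 + s ^ 2 + 4 * t := by
        field_simp
        ring
      rw [this]
      have : 0 ≤ s ^ 2 / (4 * t) := by positivity
      nlinarith [sq_nonneg (s - 1)]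
    exact h3.trans (by gcongr)
  convert ((aux_BN_const a A).mul h1).mul (aux_BN_coth ha) using 2 with s
  unfold aux_g
  ring

lemma aux_BN_p {a : ℝ} (ha : 0 < a) (t : ℝ) : aux_BN a (aux_p t) :=
  (((aux_BN_inv ha).mul (aux_BN_isinh ha)).sub ((aux_BN_coth ha).mul (aux_BN_isinh ha))).sub
    ((aux_BN_const a (1 / (2 * t))).mul (aux_BN_sdiv ha))

lemma aux_BN_q {a : ℝ} (ha : 0 < a) (t : ℝ) : aux_BN a (aux_q t) := by
  have i := aux_BN_inv ha
  have b := aux_BN_isinh ha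
  have k := aux_BN_coth ha
  have m := aux_BN_sdiv ha
  exact ((((i.mul i).mul (b.mul b)).add ((i.mul k).mul (b.mul b))).neg.add
    ((b.mul b).neg.add ((aux_BN_const a 2).mul ((k.mul k).mul (b.mul b))))).add
    ((aux_BN_const a (1 / (2 * t))).mul ((b.mul b).neg.add ((m.mul k).mul b)))

noncomputable def aux_I (h : ℝ → ℝ) (x : ℝ) : ℝ :=
  ∫ u in Ioi (0:ℝ), h (arcosh (x + u)) * u ^ (-(1 : ℝ) / 2)

lemma aux_int (a : ℝ) (ha : 1 < a) :
    IntegrableOn (fun u : ℝ => (a + u)⁻¹ * u ^ (-(1 : ℝ) / 2)) (Ioi 0) := by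
  have hmeas : Measurable (fun u : ℝ => (a + u)⁻¹ * u ^ (-(1 : ℝ) / 2)) := by fun_prop
  rw [← Ioc_union_Ioi_eq_Ioi (zero_le_one (α := ℝ))]
  refine IntegrableOn.union ?_ ?_
  · have h := (intervalIntegral.intervalIntegrable_rpow' (a := 0) (b := 1)
      (r := -(1 : ℝ) / 2) (by norm_num))
    rw [intervalIntegrable_iff_integrableOn_Ioc_of_le zero_le_one] at h
    refine h.mono' hmeas.aestronglyMeasurable ?_
    filter_upwards [ae_restrict_mem measurableSet_Ioc] with u hu
    have hu0 := hu.1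
    rw [norm_of_nonneg (by positivity)]
    have : (a + u)⁻¹ ≤ 1 := inv_le_one_of_one_le₀ (by linarith)
    exact mul_le_of_le_one_left (by positivity) this
  · have h := integrableOn_Ioi_rpow_of_lt (a := -(3 : ℝ) / 2) (c := 1) (by norm_num) one_pos
    refine h.mono' hmeas.aestronglyMeasurable ?_
    filter_upwards [ae_restrict_mem measurableSet_Ioi] with u hu
    have hu0 : 0 < u := lt_trans one_pos hu
    rw [norm_of_nonneg (by positivity)]
    have : u ^ (-(3 : ℝ) / 2) = u⁻¹ * u ^ (-(1 : ℝ) / 2) := by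
      rw [← rpow_neg_one, ← rpow_add hu0]; norm_num
    rw [this]
    gcongr
    linarith

lemma aux_cont {h : ℝ → ℝ} (hc : ContinuousOn h (Ioi 0)) {x : ℝ} (hx : 1 < x) :
    AEStronglyMeasurable (fun u => h (arcosh (x + u)) * u ^ (-(1 : ℝ) / 2))
      (volume.restrict (Ioi 0)) := by
  apply ContinuousOn.aestronglyMeasurable _ measurableSet_Ioi
  apply ContinuousOn.mul
  · refine hc.comp (continuousOn_arcosh.comp (by fun_prop) ?_) ?_
    · intro u hu
      have : 0 < u := hu
      exact mem_Ici.2 (by linarith)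
    · intro u hu
      have : 0 < u := hu
      exact arcosh_pos (by linarith)
  · intro u hu
    exact (continuousAt_rpow_const u _ (Or.inl (ne_of_gt hu))).continuousWithinAt

lemma aux_bound {h : ℝ → ℝ} (hb : ∀ a, 0 < a → aux_BN a (fun s => h s * cosh s))
    {b : ℝ} (hb1 : 1 < b) : ∃ C, ∀ x, b ≤ x → ∀ u, 0 < u →
      ‖h (arcosh (x + u)) * u ^ (-(1 : ℝ) / 2)‖ ≤ C * ((b + u)⁻¹ * u ^ (-(1 : ℝ) / 2)) := by
  obtain ⟨C, hC⟩ := hb (arcosh b) (arcosh_pos hb1)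
  refine ⟨C, fun x hx u hu => ?_⟩
  have h1 : arcosh b ≤ arcosh (x + u) :=
    (arcosh_le_arcosh (by linarith) (by linarith)).2 (by linarith)
  have h2 : |h (arcosh (x + u)) * cosh (arcosh (x + u))| ≤ C := hC _ h1
  rw [cosh_arcosh (by linarith), abs_mul, abs_of_pos (by linarith : 0 < x + u)] at h2
  have hC0 : 0 ≤ C := (mul_nonneg (abs_nonneg _) (by linarith)).trans h2
  rw [norm_mul, norm_of_nonneg (by positivity : 0 ≤ u ^ (-(1 : ℝ) / 2)), ← mul_assoc, norm_eq_abs]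
  gcongr
  have h3 : |h (arcosh (x + u))| ≤ C * (x + u)⁻¹ := by
    rw [← div_eq_mul_inv, le_div_iff₀ (by linarith)]; exact h2
  refine h3.trans ?_
  gcongr

lemma aux_integrable {h : ℝ → ℝ} (hc : ContinuousOn h (Ioi 0))
    (hb : ∀ a, 0 < a → aux_BN a (fun s => h s * cosh s)) {x : ℝ} (hx : 1 < x) :
    IntegrableOn (fun u => h (arcosh (x + u)) * u ^ (-(1 : ℝ) / 2)) (Ioi 0) := by
  obtain ⟨C, hC⟩ := aux_bound hb hx
  refine Integrable.mono' ((aux_int x hx).const_mul C) (aux_cont hc hx) ?_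
  filter_upwards [ae_restrict_mem measurableSet_Ioi] with u hu
  exact hC x le_rfl u hu

lemma aux_deriv {h h' : ℝ → ℝ} (hd : ∀ s, 0 < s → HasDerivAt h (h' s * sinh s) s)
    (hc' : ContinuousOn h' (Ioi 0))
    (hb : ∀ a, 0 < a → aux_BN a (fun s => h s * cosh s))
    (hb' : ∀ a, 0 < a → aux_BN a (fun s => h' s * cosh s)) {x : ℝ} (hx : 1 < x) :
    HasDerivAt (aux_I h) (aux_I h' x) x := by
  have hc : ContinuousOn h (Ioi 0) := fun s hs => (hd s hs).continuousAt.continuousWithinAt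
  obtain ⟨b, hb1, hbx⟩ := exists_between hx
  obtain ⟨C, hC⟩ := aux_bound hb' hb1
  refine (hasDerivAt_integral_of_dominated_loc_of_deriv_le
    (F := fun x u => h (arcosh (x + u)) * u ^ (-(1 : ℝ) / 2))
    (F' := fun x u => h' (arcosh (x + u)) * u ^ (-(1 : ℝ) / 2))
    (bound := fun u => C * ((b + u)⁻¹ * u ^ (-(1 : ℝ) / 2)))
    (μ := volume.restrict (Ioi 0)) (s := Ioi b) (Ioi_mem_nhds hbx) ?_
    (aux_integrable hc hb hx) (aux_cont hc' hx) ?_ ((aux_int b hb1).const_mul C) ?_).2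
  · filter_upwards [Ioi_mem_nhds hx] with y hy
    exact aux_cont hc hy
  · filter_upwards [ae_restrict_mem measurableSet_Ioi] with u hu y hy
    exact hC y (le_of_lt hy) u hu
  · filter_upwards [ae_restrict_mem measurableSet_Ioi] with u hu y hy
    have hu0 : 0 < u := hu
    have hy0 : b < y := hy
    have hyu : 1 < y + u := by linarith
    have h1 := (hasDerivAt_arcosh hyu)
    rw [← sinh_arcosh hyu.le] at h1
    have h0 := arcosh_pos hyu
    have h2 := (((hd _ h0).comp (y + u) h1).comp_add_const y u).mul_const (u ^ (-(1 : ℝ) / 2))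
    have hS := sinh_pos_iff.2 h0
    refine HasDerivAt.congr_deriv h2 ?_
    field_simp

lemma aux_K₂ (t ρ : ℝ) (hρ : 0 < ρ) :
    K₂ t ρ = aux_I (aux_g (exp ((3 / 4) * t) * (4 * π * t) ^ (-(3 : ℝ) / 2) * exp (-t)) t)
      (cosh ρ) := by
  have himg : (fun s => cosh s - cosh ρ) '' (Ioi ρ) = Ioi 0 := by
    ext u
    constructor
    · rintro ⟨s, hs, rfl⟩
      have hs' : ρ < s := hs
      have : cosh ρ < cosh s := by
        rw [cosh_lt_cosh, abs_of_pos hρ, abs_of_pos (hρ.trans hs')]; exact hs'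
      exact sub_pos.2 this
    · intro hu
      have hu0 : 0 < u := hu
      have h1 := one_le_cosh ρ
      refine ⟨arcosh (cosh ρ + u), ?_, ?_⟩
      · have : arcosh (cosh ρ) < arcosh (cosh ρ + u) :=
          (arcosh_lt_arcosh (by linarith) (by linarith)).2 (by linarith)
        rwa [arcosh_cosh hρ.le] at this
      · simp only
        rw [cosh_arcosh (by linarith)]; ring
  unfold aux_I
  rw [← himg, integral_image_eq_integral_abs_deriv_smul measurableSet_Ioi (f' := sinh)]
  · unfold K₂
    refine setIntegral_congr_fun measurableSet_Ioi fun s hs => ?_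
    have hs0 : 0 < s := hρ.trans hs
    have hS := sinh_pos_iff.2 hs0
    simp only [smul_eq_mul]
    rw [abs_of_pos hS, add_sub_cancel, arcosh_cosh hs0.le]
    unfold K₃ aux_g
    rw [sub_eq_add_neg (-t), exp_add]
    ring
  · intro s _
    exact ((hasDerivAt_cosh s).sub_const _).hasDerivWithinAt
  · intro s hs r hr hsr
    have hs0 : 0 < s := hρ.trans hs
    have hr0 : 0 < r := hρ.trans hr
    have : cosh s = cosh r := by simpa using hsr
    rw [← arcosh_cosh hs0.le, this, arcosh_cosh hr0.le]

lemma aux_I_pos {h : ℝ → ℝ} (hc : ContinuousOn h (Ioi 0)) (hp : ∀ s, 0 < s → 0 < h s)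
    (hb : ∀ a, 0 < a → aux_BN a (fun s => h s * cosh s)) {x : ℝ} (hx : 1 < x) :
    0 < aux_I h x := by
  have hpos : ∀ u ∈ Ioi (0:ℝ), 0 < h (arcosh (x + u)) * u ^ (-(1 : ℝ) / 2) := by
    intro u hu
    have hu0 : 0 < u := hu
    exact mul_pos (hp _ (arcosh_pos (by linarith))) (rpow_pos_of_pos hu0 _)
  unfold aux_I
  rw [setIntegral_pos_iff_support_of_nonneg_ae]
  · have : Function.support (fun u => h (arcosh (x + u)) * u ^ (-(1 : ℝ) / 2)) ∩ Ioi 0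
        = Ioi 0 := inter_eq_right.2 fun u hu => (hpos u hu).ne'
    rw [this]; simp
  · filter_upwards [ae_restrict_mem measurableSet_Ioi] with u hu
    exact (hpos u hu).le
  · exact aux_integrable hc hb hx

lemma aux_q_cont (t : ℝ) : ContinuousOn (aux_q t) (Ioi 0) := by
  unfold aux_q
  have h1 : ∀ s ∈ Ioi (0:ℝ), s ≠ 0 := fun s hs => ne_of_gt hs
  have h2 : ∀ s ∈ Ioi (0:ℝ), sinh s ≠ 0 := fun s hs => (sinh_pos_iff.2 hs).ne'
  fun_prop (disch := assumption)

end helpers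

theorem stmt_15 (t : ℝ) (ht : 0 < t) (ρ : ℝ) (hρ : 0 < ρ) :
    0 < deriv (deriv (fun r => Real.log (K₂ t r))) ρ -
        (Real.cosh ρ / Real.sinh ρ) * deriv (fun r => Real.log (K₂ t r)) ρ := by
  set A : ℝ := exp ((3 / 4) * t) * (4 * π * t) ^ (-(3 : ℝ) / 2) * exp (-t) with hA
  have hA0 : 0 < A := by positivity
  set g := aux_g A t with hg
  set g1 : ℝ → ℝ := fun s => g s * aux_p t s with hg1
  set g2 : ℝ → ℝ := fun s => g s * (aux_p t s * aux_p t s + aux_q t s) with hg2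
  have dg : ∀ s, 0 < s → HasDerivAt g (g1 s * sinh s) s := fun s hs => aux_g_deriv A t s ht hs
  have dg1 : ∀ s, 0 < s → HasDerivAt g1 (g2 s * sinh s) s := fun s hs => aux_gp_deriv A t s ht hs
  have cg : ContinuousOn g (Set.Ioi 0) := fun s hs => (dg s hs).continuousAt.continuousWithinAt
  have cg1 : ContinuousOn g1 (Set.Ioi 0) := fun s hs => (dg1 s hs).continuousAt.continuousWithinAt
  have cp : ContinuousOn (aux_p t) (Set.Ioi 0) :=
    fun s hs => (aux_p_deriv t s ht hs).continuousAt.continuousWithinAt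
  have cg2 : ContinuousOn g2 (Set.Ioi 0) := cg.mul ((cp.mul cp).add (aux_q_cont t))
  have bg : ∀ a, 0 < a → aux_BN a (fun s => g s * cosh s) := fun a ha => aux_BN_g ha A t ht
  have bg1 : ∀ a, 0 < a → aux_BN a (fun s => g1 s * cosh s) := fun a ha => by
    convert (bg a ha).mul (aux_BN_p ha t) using 2 with s
    simp only [hg1]; ring
  have bg2 : ∀ a, 0 < a → aux_BN a (fun s => g2 s * cosh s) := fun a ha => by
    convert (bg a ha).mul (((aux_BN_p ha t).mul (aux_BN_p ha t)).add (aux_BN_q ha t)) using 2 with s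
    simp only [hg2]; ring
  have pg : ∀ s, 0 < s → 0 < g s := fun s hs => by
    have hS := sinh_pos_iff.2 hs
    rw [hg]; unfold aux_g; positivity
  have dI : ∀ x, 1 < x → HasDerivAt (aux_I g) (aux_I g1 x) x :=
    fun x hx => aux_deriv dg cg1 bg bg1 hx
  have dI1 : ∀ x, 1 < x → HasDerivAt (aux_I g1) (aux_I g2 x) x :=
    fun x hx => aux_deriv dg1 cg2 bg1 bg2 hx
  have pI : ∀ x, 1 < x → 0 < aux_I g x := fun x hx => aux_I_pos cg pg bg hx
  have key : ∀ x, 1 < x → aux_I g1 x ^ 2 < aux_I g2 x * aux_I g x := by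
    intro x hx
    set l : ℝ := -(aux_I g1 x / aux_I g x) with hl
    have h1 : 0 < aux_I (fun s => g2 s + 2 * l * g1 s + l ^ 2 * g s) x := by
      refine aux_I_pos ?_ ?_ ?_ hx
      · exact (cg2.add (cg1.const_smul (2 * l))).add (cg.const_smul (l ^ 2))
      · intro s hs
        have : g2 s + 2 * l * g1 s + l ^ 2 * g s
            = g s * ((aux_p t s + l) ^ 2 + aux_q t s) := by
          simp only [hg1, hg2]; ring
        rw [this]
        have := pg s hs
        have := aux_q_pos t s ht hs
        positivity
      · intro a ha
        convert ((bg2 a ha).add ((aux_BN_const a (2 * l)).mul (bg1 a ha))).add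
          ((aux_BN_const a (l ^ 2)).mul (bg a ha)) using 2 with s
        ring
    have h2 : aux_I (fun s => g2 s + 2 * l * g1 s + l ^ 2 * g s) x
        = aux_I g2 x + 2 * l * aux_I g1 x + l ^ 2 * aux_I g x := by
      have i := aux_integrable cg bg hx
      have i1 := aux_integrable cg1 bg1 hx
      have i2 := aux_integrable cg2 bg2 hx
      unfold aux_I
      rw [← integral_const_mul, ← integral_const_mul, ← integral_add i2 (i1.const_mul _),
        ← integral_add (by exact i2.add (i1.const_mul _)) (i.const_mul _)]
      congr 1
      ext u
      simp only [Pi.add_apply]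
      ring
    rw [h2] at h1
    have hp := pI x hx
    have h3 := mul_pos h1 hp
    have h4 : (aux_I g2 x + 2 * l * aux_I g1 x + l ^ 2 * aux_I g x) * aux_I g x
        = aux_I g2 x * aux_I g x - aux_I g1 x ^ 2 := by
      rw [hl]; field_simp; ring
    linarith
  have hone : ∀ r, 0 < r → 1 < cosh r := fun r hr => one_lt_cosh.2 hr.ne'
  have d1 : ∀ r, 0 < r → HasDerivAt (fun r => Real.log (K₂ t r))
      (aux_I g1 (cosh r) * sinh r / aux_I g (cosh r)) r := by
    intro r hr
    have h := ((dI _ (hone r hr)).comp r (hasDerivAt_cosh r)).log (pI _ (hone r hr)).ne'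
    refine h.congr_of_eventuallyEq ?_
    filter_upwards [Ioi_mem_nhds hr] with y hy
    rw [aux_K₂ t y hy]
    rfl
  have e1 : deriv (fun r => Real.log (K₂ t r)) =ᶠ[nhds ρ]
      fun r => aux_I g1 (cosh r) * sinh r / aux_I g (cosh r) := by
    filter_upwards [Ioi_mem_nhds hρ] with y hy
    exact (d1 y hy).deriv
  have h1 := hone ρ hρ
  have hp := pI _ h1
  have d2 := ((((dI1 _ h1).comp ρ (hasDerivAt_cosh ρ)).mul (hasDerivAt_sinh ρ)).div
    ((dI _ h1).comp ρ (hasDerivAt_cosh ρ)) hp.ne')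
  rw [(d2.congr_of_eventuallyEq e1).deriv, (d1 ρ hρ).deriv]
  have hS := sinh_pos_iff.2 hρ
  have hk := sub_pos.2 (key _ h1)
  simp only [Function.comp, Pi.mul_apply]
  have : 0 < sinh ρ ^ 2 * (aux_I g2 (cosh ρ) * aux_I g (cosh ρ) - aux_I g1 (cosh ρ) ^ 2)
      / aux_I g (cosh ρ) ^ 2 := by positivity
  convert this using 1
  field_simp
  ring
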